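/- arXiv:math/0612217 — 4 statements merged into one kernel-verified Lean document; each statement's English description precedes it below -/
import Mathlib

section
/- Let φ : ℝ → ℝ be continuous with compact support and φ(0) = 1. For λ > 0 set F(λ) := ∫_ℝ (ξ² + φ(ξ)²)^{-(λ+1)/2} dξ. Then λ·F(λ) → 2 as λ → 0⁺ (i.e. along real λ tending to 0 from the right). In particular the residue at λ = 0 of the family of integrals is independent of the choice of φ and equals 2. -/
open MeasureTheory Filter Set

lemma eqOn_Ioi_rpow_of_eq_zero {φ : ℝ → ℝ} {R : ℝ} (hR : 0 < R) (hφ : ∀ x, R ≤ |x| → φ x = 0)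
    (l : ℝ) : EqOn (fun x : ℝ => x ^ (-(l + 1)))
      (fun x => (x ^ 2 + φ x ^ 2) ^ (-(l + 1) / 2)) (Ioi R) := by
  intro x hx
  have hx' : R < x := hx
  have hx0 : 0 < x := hR.trans hx'
  simp only [hφ x (hx'.le.trans (le_abs_self x))]
  rw [← Real.rpow_natCast x 2, zero_pow two_ne_zero, add_zero, ← Real.rpow_mul hx0.le]
  congr 1
  push_cast
  ring

lemma integrableOn_Ioi_of_eq_zero {φ : ℝ → ℝ} {R l : ℝ} (hR : 0 < R)
    (hφ : ∀ x, R ≤ |x| → φ x = 0) (hl : 0 < l) :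
    IntegrableOn (fun x : ℝ => (x ^ 2 + φ x ^ 2) ^ (-(l + 1) / 2)) (Ioi R) :=
  (integrableOn_Ioi_rpow_of_lt (by linarith) hR).congr_fun
    (eqOn_Ioi_rpow_of_eq_zero hR hφ l) measurableSet_Ioi

lemma integral_Ioi_of_eq_zero {φ : ℝ → ℝ} {R l : ℝ} (hR : 0 < R)
    (hφ : ∀ x, R ≤ |x| → φ x = 0) (hl : 0 < l) :
    ∫ x in Ioi R, (x ^ 2 + φ x ^ 2) ^ (-(l + 1) / 2) = R ^ (-l) / l := by
  rw [← setIntegral_congr_fun measurableSet_Ioi (eqOn_Ioi_rpow_of_eq_zero hR hφ l),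
    integral_Ioi_rpow_of_lt (by linarith) hR, show -(l + 1) + 1 = -l by ring, neg_div_neg_eq]

lemma integral_eq_integral_Icc_add {φ : ℝ → ℝ} (hc : Continuous φ)
    (hpos : ∀ x, 0 < x ^ 2 + φ x ^ 2) {R l : ℝ} (hR : 0 < R)
    (hφ : ∀ x, R ≤ |x| → φ x = 0) (hl : 0 < l) :
    ∫ x : ℝ, (x ^ 2 + φ x ^ 2) ^ (-(l + 1) / 2) =
      (∫ x in Icc (-R) R, (x ^ 2 + φ x ^ 2) ^ (-(l + 1) / 2)) + 2 * (R ^ (-l) / l) := by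
  set f : ℝ → ℝ := fun x => (x ^ 2 + φ x ^ 2) ^ (-(l + 1) / 2) with hf
  have hfc : Continuous f :=
    Continuous.rpow_const (by fun_prop) fun x => Or.inl (hpos x).ne'
  have hφ' : ∀ x, R ≤ |x| → (fun y => φ (-y)) x = 0 := fun x hx => hφ _ (by rwa [abs_neg])
  have hneg : (fun x : ℝ => (x ^ 2 + (fun y => φ (-y)) x ^ 2) ^ (-(l + 1) / 2)) =
      fun x => f (-x) := by
    ext x
    simp [hf]
  have hIoi : IntegrableOn f (Ioi R) := integrableOn_Ioi_of_eq_zero hR hφ hl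
  have hIic : IntegrableOn f (Iic (-R)) := by
    have h := integrableOn_Ioi_of_eq_zero hR hφ' hl
    rw [hneg] at h
    have h2 := (integrableOn_Ici_iff_integrableOn_Ioi).2 h
    rw [← neg_neg R] at h2
    simpa using h2.comp_neg_Iic
  have hIoc : IntegrableOn f (Ioc (-R) R) :=
    (hfc.integrableOn_Icc).mono_set Ioc_subset_Icc_self
  have hU : Ioc (-R) R ∪ Ioi R = Ioi (-R) := Ioc_union_Ioi_eq_Ioi (by linarith)
  have hleft : ∫ x in Iic (-R), f x = R ^ (-l) / l := by
    rw [← integral_Ioi_of_eq_zero hR hφ' hl, hneg, integral_comp_neg_Ioi]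
  have hright : ∫ x in Ioi R, f x = R ^ (-l) / l := integral_Ioi_of_eq_zero hR hφ hl
  rw [← intervalIntegral.integral_Iic_add_Ioi hIic (hU ▸ hIoc.union hIoi), ← hU,
    setIntegral_union Ioc_disjoint_Ioi_same measurableSet_Ioi hIoc hIoi, hleft, hright,
    integral_Icc_eq_integral_Ioc]
  ring

lemma exists_norm_integral_Icc_le {g : ℝ → ℝ} (hg : Continuous g) (hpos : ∀ x, 0 < g x)
    {R : ℝ} (hR : 0 < R) :
    ∃ C, ∀ a : ℝ, -1 ≤ a → a ≤ 0 → ‖∫ x in Icc (-R) R, g x ^ a‖ ≤ C := by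
  obtain ⟨x₀, -, hx₀⟩ := isCompact_Icc.exists_isMinOn
    (nonempty_Icc.2 (by linarith : -R ≤ R)) hg.continuousOn
  have hm : 0 < min (g x₀) 1 := lt_min (hpos x₀) one_pos
  refine ⟨min (g x₀) 1 ^ (-1 : ℝ) * volume.real (Icc (-R) R), fun a ha ha' => ?_⟩
  refine norm_setIntegral_le_of_norm_le_const isCompact_Icc.measure_lt_top fun x hx => ?_
  rw [Real.norm_of_nonneg (Real.rpow_nonneg (hpos x).le _)]
  calc g x ^ a ≤ min (g x₀) 1 ^ a :=
        Real.rpow_le_rpow_of_nonpos hm ((min_le_left _ _).trans (hx₀ hx)) ha'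
    _ ≤ min (g x₀) 1 ^ (-1 : ℝ) :=
        Real.rpow_le_rpow_of_exponent_ge hm (min_le_right _ _) ha

/-- Let `φ : ℝ → ℝ` be continuous with compact support and `φ 0 = 1`. For `λ > 0` set
`F λ = ∫ ξ, (ξ² + φ ξ ²) ^ (-(λ+1)/2)`. Then `λ * F λ → 2` as `λ → 0⁺`. -/
theorem residue_of_integral_family (φ : ℝ → ℝ) (hφ_cont : Continuous φ)
    (hφ_supp : HasCompactSupport φ) (hφ0 : φ 0 = 1) :
    Tendsto (fun lam : ℝ => lam * ∫ ξ : ℝ, (ξ ^ 2 + φ ξ ^ 2) ^ (-(lam + 1) / 2))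
      (nhdsWithin 0 (Ioi 0)) (nhds 2) := by
  have hpos : ∀ x, 0 < x ^ 2 + φ x ^ 2 := by
    intro x
    rcases eq_or_ne x 0 with rfl | hx
    · simp [hφ0]
    · positivity
  obtain ⟨R, hR, hφ⟩ : ∃ R, 0 < R ∧ ∀ x, R ≤ |x| → φ x = 0 :=
    hφ_supp.exists_pos_le_norm
  obtain ⟨C, hC⟩ := exists_norm_integral_Icc_le
    (by fun_prop : Continuous fun x => x ^ 2 + φ x ^ 2) hpos hR
  have hid : Tendsto (fun l : ℝ => l) (nhdsWithin 0 (Ioi 0)) (nhds 0) :=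
    tendsto_id.mono_left nhdsWithin_le_nhds
  have hcompact : Tendsto
      (fun l : ℝ => l * ∫ x in Icc (-R) R, (x ^ 2 + φ x ^ 2) ^ (-(l + 1) / 2))
      (nhdsWithin 0 (Ioi 0)) (nhds 0) := by
    refine hid.zero_mul_isBoundedUnder_le (isBoundedUnder_of_eventually_le (a := C) ?_)
    filter_upwards [Ioo_mem_nhdsGT (zero_lt_one' ℝ)] with l hl
    exact hC _ (by linarith [hl.2]) (by linarith [hl.1])
  have htail : Tendsto (fun l : ℝ => 2 * R ^ (-l)) (nhdsWithin 0 (Ioi 0)) (nhds 2) := by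
    have h := (tendsto_const_nhds (x := R)).rpow hid.neg (Or.inl hR.ne')
    simpa using h.const_mul 2
  have hsum := hcompact.add htail
  rw [zero_add] at hsum
  refine hsum.congr' ?_
  filter_upwards [self_mem_nhdsWithin] with l hl
  have hl0 : 0 < l := hl
  rw [integral_eq_integral_Icc_add hφ_cont hpos hR hφ hl0]
  field_simp
end

section
/- Let φ₁, φ₂ : ℝ → ℝ both be continuous with compact support and φ₁(0) = φ₂(0) = 1. Then, as λ → 0⁺, the difference ∫_ℝ (ξ² + φ₁(ξ)²)^{-(λ+1)/2} dξ − ∫_ℝ (ξ² + φ₂(ξ)²)^{-(λ+1)/2} dξ converges to the finite limit ∫_ℝ ((ξ² + φ₁(ξ)²)^{-1/2} − (ξ² + φ₂(ξ)²)^{-1/2}) dξ; in particular the integrand of the limit is Lebesgue integrable on ℝ. -/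
open MeasureTheory Filter Set

lemma sq_add_sq_pos_of_map_zero {φ : ℝ → ℝ} (h0 : φ 0 = 1) (ξ : ℝ) : 0 < ξ ^ 2 + φ ξ ^ 2 := by
  rcases eq_or_ne ξ 0 with rfl | h
  · simp [h0]
  · positivity

lemma continuous_uncurry_sq_add_sq_rpow {φ : ℝ → ℝ} (hφ : Continuous φ) (h0 : φ 0 = 1) :
    Continuous (Function.uncurry fun l ξ : ℝ => (ξ ^ 2 + φ ξ ^ 2) ^ (-(l + 1) / 2)) := by
  refine Continuous.rpow (by fun_prop) (by fun_prop) fun x => Or.inl ?_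
  exact (sq_add_sq_pos_of_map_zero h0 x.2).ne'

lemma integrable_sq_add_sq_rpow {φ : ℝ → ℝ} (hφ : Continuous φ) (h0 : φ 0 = 1) {r : ℝ}
    (hr : 1 < r) : Integrable fun ξ : ℝ => (ξ ^ 2 + φ ξ ^ 2) ^ (-r / 2) := by
  have hc : Continuous fun ξ : ℝ => (ξ ^ 2 + φ ξ ^ 2) ^ (-r / 2) :=
    Continuous.rpow_const (by fun_prop) fun ξ => Or.inl (sq_add_sq_pos_of_map_zero h0 ξ).ne'
  have hint : Integrable fun ξ : ℝ => ((1 : ℝ) + ‖ξ‖ ^ 2) ^ (-r / 2) :=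
    integrable_rpow_neg_one_add_norm_sq (by simpa using hr)
  refine hc.locallyIntegrable.integrable_of_isBigO_cocompact
    (g := fun ξ : ℝ => ((1 : ℝ) + ‖ξ‖ ^ 2) ^ (-r / 2)) ?_ (hint.integrableAtFilter _)
  refine Asymptotics.IsBigO.of_bound ((1 / 2 : ℝ) ^ (-r / 2)) ?_
  filter_upwards [tendsto_norm_cocompact_atTop.eventually_ge_atTop (1 : ℝ)] with ξ hξ
  have hp := sq_add_sq_pos_of_map_zero h0 ξ
  rw [Real.norm_of_nonneg (by positivity), Real.norm_of_nonneg (by positivity),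
    ← Real.mul_rpow (by positivity) (by positivity)]
  refine Real.rpow_le_rpow_of_nonpos (by positivity) ?_ (by linarith)
  have h1 : 1 ≤ ‖ξ‖ ^ 2 := one_le_pow₀ hξ
  rw [Real.norm_eq_abs, sq_abs] at *
  nlinarith [sq_nonneg (φ ξ)]

/-- For `φ₁, φ₂` continuous with compact support taking the value `1` at `0`, the difference of
the two integrals converges as `λ → 0⁺` to the integral of the difference at `λ = 0`, which is
Lebesgue integrable on `ℝ`. -/
theorem difference_of_integral_families (φ₁ φ₂ : ℝ → ℝ)
    (h₁_cont : Continuous φ₁) (h₁_supp : HasCompactSupport φ₁) (h₁0 : φ₁ 0 = 1)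
    (h₂_cont : Continuous φ₂) (h₂_supp : HasCompactSupport φ₂) (h₂0 : φ₂ 0 = 1) :
    Integrable (fun ξ : ℝ =>
        (ξ ^ 2 + φ₁ ξ ^ 2) ^ (-(1 : ℝ) / 2) - (ξ ^ 2 + φ₂ ξ ^ 2) ^ (-(1 : ℝ) / 2)) ∧
    Tendsto (fun lam : ℝ =>
        (∫ ξ : ℝ, (ξ ^ 2 + φ₁ ξ ^ 2) ^ (-(lam + 1) / 2))
          - ∫ ξ : ℝ, (ξ ^ 2 + φ₂ ξ ^ 2) ^ (-(lam + 1) / 2))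
      (nhdsWithin 0 (Ioi 0))
      (nhds (∫ ξ : ℝ,
        ((ξ ^ 2 + φ₁ ξ ^ 2) ^ (-(1 : ℝ) / 2) - (ξ ^ 2 + φ₂ ξ ^ 2) ^ (-(1 : ℝ) / 2)))) := by
  set F : ℝ → ℝ → ℝ := fun l ξ =>
    (ξ ^ 2 + φ₁ ξ ^ 2) ^ (-(l + 1) / 2) - (ξ ^ 2 + φ₂ ξ ^ 2) ^ (-(l + 1) / 2) with hF
  set K : Set ℝ := tsupport φ₁ ∪ tsupport φ₂
  have hK : IsCompact K := h₁_supp.isCompact.union h₂_supp.isCompact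
  have hFK (l ξ : ℝ) (hξ : ξ ∉ K) : F l ξ = 0 := by
    obtain ⟨h₁, h₂⟩ := not_or.mp hξ
    simp [hF, image_eq_zero_of_notMem_tsupport h₁, image_eq_zero_of_notMem_tsupport h₂]
  have hFc : Continuous (Function.uncurry F) :=
    (continuous_uncurry_sq_add_sq_rpow h₁_cont h₁0).sub
      (continuous_uncurry_sq_add_sq_rpow h₂_cont h₂0)
  have hF0 : (fun ξ : ℝ => (ξ ^ 2 + φ₁ ξ ^ 2) ^ (-(1 : ℝ) / 2)
      - (ξ ^ 2 + φ₂ ξ ^ 2) ^ (-(1 : ℝ) / 2)) = F 0 := by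
    simp [hF]
  rw [hF0]
  refine ⟨(hFc.uncurry_left 0).integrable_of_hasCompactSupport
    (HasCompactSupport.intro hK (hFK 0)), ?_⟩
  have hcont : Continuous fun l => ∫ ξ, F l ξ := by
    simp_rw [← fun l => setIntegral_eq_integral_of_forall_compl_eq_zero (μ := volume) (hFK l)]
    exact continuous_parametric_integral_of_continuous hFc hK
  refine ((hcont.tendsto 0).mono_left nhdsWithin_le_nhds).congr' ?_
  filter_upwards [self_mem_nhdsWithin] with l (hl : 0 < l)
  exact integral_sub (integrable_sq_add_sq_rpow h₁_cont h₁0 (by linarith))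
    (integrable_sq_add_sq_rpow h₂_cont h₂0 (by linarith))
end

section
/- Let B be an m×n complex matrix and f : ℝ → ℝ a continuous function. Then trace(f(BᴴB)) − trace(f(BBᴴ)) = (n − m)·f(0), where f is applied via the continuous functional calculus to the Hermitian positive-semidefinite matrices BᴴB (of size n×n) and BBᴴ (of size m×m), and the equality is in ℂ with n − m and f(0) coerced to ℂ. -/
open Matrix

namespace Matrix

variable {ι κ 𝕜 : Type*} [RCLike 𝕜] [Fintype ι] [DecidableEq ι] [Fintype κ] [DecidableEq κ]

/-- The trace of `f(A)` is the sum of the values of `f` at the roots of the characteristic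
polynomial of the Hermitian matrix `A`. -/
lemma IsHermitian.trace_cfc_eq_sum_roots_charpoly {A : Matrix ι ι 𝕜} (hA : A.IsHermitian)
    (f : ℝ → ℝ) :
    (cfc f A).trace = (A.charpoly.roots.map fun z ↦ (f (RCLike.re z) : 𝕜)).sum := by
  rw [hA.cfc_eq, IsHermitian.cfc, Unitary.conjStarAlgAut_apply, trace_mul_comm, ← mul_assoc,
    Unitary.coe_star_mul_self, one_mul, trace_diagonal, hA.roots_charpoly_eq_eigenvalues]
  simp

open Polynomial in
/-- The roots of the characteristic polynomials of `A * B` and `B * A` agree up to zeros. -/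
lemma replicate_zero_add_roots_charpoly_mul_comm {R : Type*} [CommRing R] [IsDomain R]
    (A : Matrix ι κ R) (B : Matrix κ ι R) :
    Multiset.replicate (Fintype.card κ) 0 + (A * B).charpoly.roots =
      Multiset.replicate (Fintype.card ι) 0 + (B * A).charpoly.roots := by
  have h := congrArg roots (charpoly_mul_comm' A B)
  rwa [roots_mul (((monic_X_pow _).mul (charpoly_monic _)).ne_zero),
    roots_mul (((monic_X_pow _).mul (charpoly_monic _)).ne_zero), roots_X_pow, roots_X_pow,
    Multiset.nsmul_singleton, Multiset.nsmul_singleton] at h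

end Matrix

/-- For an `m × n` complex matrix `B` and a continuous `f : ℝ → ℝ`,
`trace (f(BᴴB)) − trace (f(BBᴴ)) = (n − m)·f(0)`, where `f` is applied via the continuous
functional calculus. -/
theorem trace_cfc_conjTranspose_mul_sub_trace_cfc_mul_conjTranspose {m n : ℕ}
    (B : Matrix (Fin m) (Fin n) ℂ) (f : ℝ → ℝ) (hf : Continuous f) :
    (cfc f (Bᴴ * B)).trace - (cfc f (B * Bᴴ)).trace = ((n : ℂ) - (m : ℂ)) * (f 0 : ℂ) := by
  rw [(isHermitian_conjTranspose_mul_self B).trace_cfc_eq_sum_roots_charpoly,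
    (isHermitian_mul_conjTranspose_self B).trace_cfc_eq_sum_roots_charpoly]
  have h := congrArg (fun s ↦ (s.map fun z : ℂ ↦ (f (RCLike.re z) : ℂ)).sum)
    (replicate_zero_add_roots_charpoly_mul_comm Bᴴ B)
  simp only [Multiset.map_add, Multiset.sum_add, Multiset.map_replicate, Multiset.sum_replicate,
    Fintype.card_fin, map_zero, nsmul_eq_mul] at h
  linear_combination h
end

section
/- Let B be an m×n complex matrix, c > 0 and p > 0 real numbers, and f : ℝ → ℝ a continuous function. Let K be the n×n matrix of the orthogonal projection of ℂⁿ onto the kernel of B (matrix-vector multiplication by B), and K' the m×m matrix of the orthogonal projection of ℂᵐ onto the kernel of Bᴴ. Then trace(f(c·1 + BᴴB + p·K)) − trace(f(c·1 + BBᴴ + p·K')) = (n − m)·f(c + p), where f is applied via the continuous functional calculus to the two Hermitian matrices and the equality is in ℂ. -/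
open Matrix

section

variable {m n : Type*} [Fintype m] [Fintype n] [DecidableEq m] [DecidableEq n]

/-- The trace of an idempotent matrix is the rank of its range. -/
theorem Matrix.trace_eq_finrank_range_of_mul_self {R : Type*} [Field R] {K : Matrix n n R}
    (hK : K * K = K) : K.trace = (Module.finrank R (LinearMap.range K.mulVecLin) : R) := by
  have h : LinearMap.IsProj (LinearMap.range K.mulVecLin) K.mulVecLin := by
    refine ⟨fun x => LinearMap.mem_range_self _ x, ?_⟩
    rintro _ ⟨y, rfl⟩
    simp [Matrix.mulVec_mulVec, hK]
  rw [← h.trace, ← Matrix.toLin'_apply', Matrix.trace_toLin'_eq]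

open scoped ComplexOrder in
/-- If `K` and `K'` project onto the kernels of `B` and `Bᴴ`, their traces differ by the
difference of the two dimensions. -/
theorem Matrix.trace_sub_trace_of_range_eq_ker {B : Matrix m n ℂ}
    {K : Matrix n n ℂ} (hK : K * K = K)
    (hKr : LinearMap.range K.mulVecLin = LinearMap.ker B.mulVecLin)
    {K' : Matrix m m ℂ} (hK' : K' * K' = K')
    (hKr' : LinearMap.range K'.mulVecLin = LinearMap.ker Bᴴ.mulVecLin) :
    K.trace - K'.trace = (Fintype.card n : ℂ) - (Fintype.card m : ℂ) := by
  rw [trace_eq_finrank_range_of_mul_self hK, trace_eq_finrank_range_of_mul_self hK', hKr, hKr']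
  have h₁ := B.mulVecLin.finrank_range_add_finrank_ker
  have h₂ := Bᴴ.mulVecLin.finrank_range_add_finrank_ker
  have h₃ := B.rank_conjTranspose
  simp only [Module.finrank_fintype_fun_eq_card] at h₁ h₂
  unfold Matrix.rank at h₃
  rw [← h₁, ← h₂, h₃]
  push_cast
  ring

theorem Matrix.mul_eq_zero_of_range_le_ker {l R : Type*} [Fintype l] [CommRing R]
    {B : Matrix l n R} {K : Matrix n n R}
    (h : LinearMap.range K.mulVecLin ≤ LinearMap.ker B.mulVecLin) : B * K = 0 := by
  refine Matrix.ext_of_mulVec_single fun i => ?_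
  have := h (LinearMap.mem_range_self K.mulVecLin (Pi.single i 1))
  simpa only [LinearMap.mem_ker, Matrix.mulVecLin_apply, Matrix.mulVec_mulVec,
    Matrix.zero_mulVec] using this

theorem add_smul_pow_succ_of_mul_eq_zero {R A : Type*} [CommSemiring R] [Semiring A] [Algebra R A]
    {S K : A} (hK : K * K = K) (hSK : S * K = 0) (hKS : K * S = 0) (p : R) (k : ℕ) :
    (S + p • K) ^ (k + 1) = S ^ (k + 1) + p ^ (k + 1) • K := by
  induction k with
  | zero => simp
  | succ k ih =>
    have h : S ^ (k + 1) * K = 0 := by rw [pow_succ, mul_assoc, hSK, mul_zero]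
    rw [pow_succ, ih, add_mul, mul_add, mul_add, mul_smul_comm, h, smul_mul_assoc, hKS,
      smul_mul_smul_comm, hK, ← pow_succ, ← pow_succ]
    simp

theorem Matrix.trace_mul_pow_succ_comm {R : Type*} [CommSemiring R]
    (A : Matrix m n R) (B : Matrix n m R) (k : ℕ) :
    ((A * B) ^ (k + 1)).trace = ((B * A) ^ (k + 1)).trace := by
  have h : ∀ j : ℕ, (A * B) ^ j * A = A * (B * A) ^ j := by
    intro j
    induction j with
    | zero => simp
    | succ j ih =>
      rw [pow_succ', Matrix.mul_assoc, ih, pow_succ']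
      simp only [Matrix.mul_assoc]
  rw [pow_succ, ← Matrix.mul_assoc, h, Matrix.trace_mul_comm, ← Matrix.mul_assoc,
    ← pow_succ' (B * A) k]

/-- The polynomial case of the trace formula, without the scalar shift. -/
theorem Matrix.trace_aeval_sub_trace_aeval (B : Matrix m n ℂ) (p : ℝ)
    {K : Matrix n n ℂ} (hKh : Kᴴ = K) (hK : K * K = K)
    (hKr : LinearMap.range K.mulVecLin = LinearMap.ker B.mulVecLin)
    {K' : Matrix m m ℂ} (hKh' : K'ᴴ = K') (hK' : K' * K' = K')
    (hKr' : LinearMap.range K'.mulVecLin = LinearMap.ker Bᴴ.mulVecLin) (q : Polynomial ℝ) :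
    (Polynomial.aeval (Bᴴ * B + (p : ℂ) • K) q).trace
        - (Polynomial.aeval (B * Bᴴ + (p : ℂ) • K') q).trace
      = ((Fintype.card n : ℂ) - (Fintype.card m : ℂ)) * ((q.eval p : ℝ) : ℂ) := by
  induction q using Polynomial.induction_on' with
  | add q r hq hr =>
    simp only [map_add, Matrix.trace_add, Polynomial.eval_add, Complex.ofReal_add]
    linear_combination hq + hr
  | monomial k a =>
    have hBK : B * K = 0 := mul_eq_zero_of_range_le_ker hKr.le
    have hBK' : Bᴴ * K' = 0 := mul_eq_zero_of_range_le_ker hKr'.le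
    have hKB : K * Bᴴ = 0 := by simpa [hKh] using congrArg conjTranspose hBK
    have hKB' : K' * B = 0 := by simpa [hKh'] using congrArg conjTranspose hBK'
    have ht := trace_sub_trace_of_range_eq_ker hK hKr hK' hKr'
    simp only [Polynomial.aeval_monomial, ← Algebra.smul_def, Matrix.trace_smul,
      Polynomial.eval_monomial, Complex.real_smul]
    cases k with
    | zero => simp; ring
    | succ k =>
      rw [add_smul_pow_succ_of_mul_eq_zero hK (by rw [Matrix.mul_assoc, hBK, Matrix.mul_zero])
          (by rw [← Matrix.mul_assoc, hKB, Matrix.zero_mul]),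
        add_smul_pow_succ_of_mul_eq_zero hK' (by rw [Matrix.mul_assoc, hBK', Matrix.mul_zero])
          (by rw [← Matrix.mul_assoc, hKB', Matrix.zero_mul])]
      simp only [Matrix.trace_add, Matrix.trace_smul, smul_eq_mul, trace_mul_pow_succ_comm B Bᴴ]
      push_cast
      linear_combination (a : ℂ) * (p : ℂ) ^ (k + 1) * ht

theorem Set.Finite.exists_polynomial_eqOn {F : Type*} [Field F] {s : Set F} (hs : s.Finite)
    (f : F → F) : ∃ q : Polynomial F, s.EqOn f q.eval := by
  classical
  refine ⟨Lagrange.interpolate hs.toFinset id f, fun x hx => ?_⟩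
  exact (Lagrange.eval_interpolate_at_node (i := x) f Function.injective_id.injOn
    (hs.mem_toFinset.2 hx)).symm

theorem Matrix.IsHermitian.cfc_eq_aeval_of_eqOn {A : Matrix n n ℂ} (hA : A.IsHermitian)
    {f : ℝ → ℝ} {q : Polynomial ℝ} (h : (spectrum ℝ A).EqOn f q.eval) :
    cfc f A = Polynomial.aeval A q :=
  (cfc_congr h).trans (cfc_polynomial q A hA)

end

/-- For `B` an `m × n` complex matrix, `c, p > 0`, `f : ℝ → ℝ` continuous, `K` the matrix of the
orthogonal projection of `ℂⁿ` onto `ker B` (i.e. the Hermitian idempotent matrix with range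
`ker B`), and `K'` the matrix of the orthogonal projection of `ℂᵐ` onto `ker Bᴴ`, one has
`trace (f(c·1 + BᴴB + p·K)) − trace (f(c·1 + BBᴴ + p·K')) = (n − m)·f(c + p)`, where `f` is
applied via the continuous functional calculus. -/
theorem trace_cfc_shifted_difference {m n : ℕ} (B : Matrix (Fin m) (Fin n) ℂ) (c p : ℝ)
    (hc : 0 < c) (hp : 0 < p) (f : ℝ → ℝ) (hf : Continuous f)
    (K : Matrix (Fin n) (Fin n) ℂ) (hK_herm : Kᴴ = K) (hK_idem : K * K = K)
    (hK_range : LinearMap.range K.mulVecLin = LinearMap.ker B.mulVecLin)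
    (K' : Matrix (Fin m) (Fin m) ℂ) (hK'_herm : K'ᴴ = K') (hK'_idem : K' * K' = K')
    (hK'_range : LinearMap.range K'.mulVecLin = LinearMap.ker Bᴴ.mulVecLin) :
    (cfc f ((c : ℂ) • 1 + Bᴴ * B + (p : ℂ) • K)).trace
        - (cfc f ((c : ℂ) • 1 + B * Bᴴ + (p : ℂ) • K')).trace
      = ((n : ℂ) - (m : ℂ)) * (f (c + p) : ℂ) := by
  set A := (c : ℂ) • 1 + Bᴴ * B + (p : ℂ) • K with hA
  set A' := (c : ℂ) • 1 + B * Bᴴ + (p : ℂ) • K' with hA'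
  have hAh : A.IsHermitian := by
    simp [hA, Matrix.IsHermitian, conjTranspose_smul, hK_herm]
  have hAh' : A'.IsHermitian := by
    simp [hA', Matrix.IsHermitian, conjTranspose_smul, hK'_herm]
  obtain ⟨q, hq⟩ := ((A.finite_real_spectrum.union A'.finite_real_spectrum).union
    (Set.finite_singleton (c + p))).exists_polynomial_eqOn f
  rw [hAh.cfc_eq_aeval_of_eqOn (hq.mono fun x hx => .inl (.inl hx)),
    hAh'.cfc_eq_aeval_of_eqOn (hq.mono fun x hx => .inl (.inr hx)), hq (.inr rfl)]
  have h := trace_aeval_sub_trace_aeval B p hK_herm hK_idem hK_range hK'_herm hK'_idem hK'_range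
    (q.comp (.X + .C c))
  have hS : Bᴴ * B + (p : ℂ) • K + algebraMap ℝ _ c = A := by
    rw [hA, Algebra.algebraMap_eq_smul_one, ← Complex.coe_smul]
    abel
  have hS' : B * Bᴴ + (p : ℂ) • K' + algebraMap ℝ _ c = A' := by
    rw [hA', Algebra.algebraMap_eq_smul_one, ← Complex.coe_smul]
    abel
  simpa only [Polynomial.aeval_comp, map_add, Polynomial.aeval_X, Polynomial.aeval_C, hS, hS',
    Polynomial.eval_comp, Polynomial.eval_add, Polynomial.eval_X, Polynomial.eval_C,
    Fintype.card_fin, add_comm p c] using h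
end
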